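/- With σ a uniformly random permutation of {1,…,n} (n ≥ 2) and X_{n,m} the number of maximal runs of 1's among I_m(k) = 1{σ⁻¹(k) ≤ m}, the variance satisfies Var(X_{n,m}) = m(m−1)(n−m)(n−m+1)/(n²(n−1)). -/

import Mathlib

/-- Number of maximal runs of 1's in the (1-indexed) sequence `f 1, …, f n`. -/
def numRuns (n : ℕ) (f : ℕ → ℕ) : ℕ :=
  ((Finset.Icc 1 n).filter (fun k => f k = 1 ∧ (k = 1 ∨ f (k - 1) = 0))).card

/-- The indicator sequence `I_m(k) = 1{σ⁻¹(k) ≤ m}` (1-indexed). -/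
def permInd (n m : ℕ) (σ : Equiv.Perm (Fin n)) : ℕ → ℕ :=
  fun k => if h : 1 ≤ k ∧ k ≤ n then
    (if ((σ.symm ⟨k - 1, by omega⟩ : Fin n) : ℕ) + 1 ≤ m then 1 else 0) else 0

lemma numRuns_add_sum (f : ℕ → ℕ) (hf : ∀ k, f k = 0 ∨ f k = 1) (n : ℕ) :
    numRuns (n + 1) f + ∑ i ∈ Finset.range n, f (i + 1) * f (i + 2)
      = ∑ i ∈ Finset.range (n + 1), f (i + 1) := by
  have step (k : ℕ) : numRuns (k + 1) f
      = numRuns k f + if f (k + 1) = 1 ∧ (k = 0 ∨ f k = 0) then 1 else 0 := by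
    unfold numRuns
    rw [← Finset.insert_Icc_right_eq_Icc_add_one (by omega), Finset.filter_insert]
    simp only [Nat.add_sub_cancel, Nat.add_eq_right]
    split_ifs with h
    · rw [Finset.card_insert_of_notMem (by simp)]
    · simp
  induction n with
  | zero =>
    rw [step]
    rcases hf 1 with h | h <;> simp [numRuns, h]
  | succ n ih =>
    rw [step, Finset.sum_range_succ, Finset.sum_range_succ _ (n + 1), ← ih]
    rcases hf (n + 1) with h | h <;> rcases hf (n + 1 + 1) with h' | h' <;> simp [h, h'] <;> omega

lemma permInd_eq_zero_or_one (n m : ℕ) (σ : Equiv.Perm (Fin n)) (k : ℕ) :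
    permInd n m σ k = 0 ∨ permInd n m σ k = 1 := by
  unfold permInd
  split_ifs <;> simp

lemma permInd_succ {n : ℕ} (m : ℕ) (σ : Equiv.Perm (Fin n)) (i : Fin n) :
    permInd n m σ (i + 1) = if (σ.symm i : ℕ) < m then 1 else 0 := by
  simp [permInd]

lemma sum_permInd {n m : ℕ} (hm : m ≤ n) (σ : Equiv.Perm (Fin n)) :
    ∑ i ∈ Finset.range n, permInd n m σ (i + 1) = m := by
  rw [← Fin.sum_univ_eq_sum_range (fun i => permInd n m σ (i + 1))]
  simp only [permInd_succ]
  rw [Equiv.sum_comp σ.symm (fun i : Fin n => if (i : ℕ) < m then 1 else 0),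
    Fin.sum_univ_eq_sum_range (fun i => if i < m then 1 else 0), Finset.sum_boole]
  have : (Finset.range n).filter (· < m) = Finset.range m := by
    ext x; simp; omega
  simp [this]

/-- The number of permutations whose indicator sequence equals 1 at all positions in `S`. -/
def indCount (n m : ℕ) (S : Finset ℕ) : ℕ :=
  ∑ σ : Equiv.Perm (Fin n), ∏ i ∈ S, permInd n m σ (i + 1)

lemma permInd_swap_mul {n : ℕ} (m : ℕ) (σ : Equiv.Perm (Fin n)) (i j k : Fin n) :
    permInd n m (Equiv.swap i j * σ) (k + 1) = permInd n m σ (Equiv.swap i j k + 1) := by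
  rw [permInd_succ, permInd_succ]
  rfl

lemma indCount_insert_congr {n : ℕ} (m : ℕ) {S : Finset ℕ} (hS : S ⊆ Finset.range n) {i j : ℕ}
    (hi : i < n) (hj : j < n) (hiS : i ∉ S) (hjS : j ∉ S) :
    indCount n m (insert i S) = indCount n m (insert j S) := by
  unfold indCount
  rw [← Equiv.sum_comp (Equiv.mulLeft (Equiv.swap (⟨i, hi⟩ : Fin n) ⟨j, hj⟩))]
  refine Finset.sum_congr rfl fun σ _ => ?_
  rw [Finset.prod_insert hiS, Finset.prod_insert hjS]
  simp only [Equiv.coe_mulLeft]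
  congr 1
  · simpa using permInd_swap_mul m σ ⟨i, hi⟩ ⟨j, hj⟩ ⟨i, hi⟩
  · refine Finset.prod_congr rfl fun k hk => ?_
    have hkn := Finset.mem_range.1 (hS hk)
    have h := permInd_swap_mul m σ ⟨i, hi⟩ ⟨j, hj⟩ ⟨k, hkn⟩
    rwa [Equiv.swap_apply_of_ne_of_ne] at h
    · rintro ⟨⟩; exact hiS hk
    · rintro ⟨⟩; exact hjS hk

lemma indCount_insert {n m : ℕ} (hm : m ≤ n) {S : Finset ℕ} (hS : S ⊆ Finset.range n) {i : ℕ}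
    (hi : i < n) (hiS : i ∉ S) :
    S.card * indCount n m S + (n - S.card) * indCount n m (insert i S) = m * indCount n m S := by
  have total : ∑ j ∈ Finset.range n, indCount n m (insert j S) = m * indCount n m S := by
    unfold indCount
    rw [Finset.sum_comm, Finset.mul_sum]
    refine Finset.sum_congr rfl fun σ _ => ?_
    conv_rhs => lhs; rw [← sum_permInd hm σ]
    rw [Finset.sum_mul]
    refine Finset.sum_congr rfl fun j _ => ?_
    by_cases hj : j ∈ S
    · rw [Finset.insert_eq_of_mem hj]
      rcases permInd_eq_zero_or_one n m σ (j + 1) with h | h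
      · rw [Finset.prod_eq_zero hj h, mul_zero]
      · rw [h, one_mul]
    · rw [Finset.prod_insert hj]
  rw [← total, ← Finset.sum_sdiff hS, add_comm]
  congr 1
  · rw [Finset.sum_congr rfl (g := fun _ => indCount n m (insert i S))]
    · simp [Finset.card_sdiff_of_subset hS]
    · intro j hj
      rw [Finset.mem_sdiff, Finset.mem_range] at hj
      exact indCount_insert_congr m hS hj.1 hi hj.2 hiS
  · rw [Finset.sum_congr rfl (g := fun _ => indCount n m S)]
    · simp
    · intro j hj
      rw [Finset.insert_eq_of_mem hj]

lemma indCount_eq {n m : ℕ} (hm : m ≤ n) (S : Finset ℕ) (hS : S ⊆ Finset.range n) :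
    indCount n m S = m.descFactorial S.card * (n - S.card).factorial := by
  induction S using Finset.induction_on with
  | empty => simp [indCount, Fintype.card_perm]
  | insert i S hiS ih =>
    obtain ⟨hi, hS⟩ := Finset.insert_subset_iff.1 hS
    have h := indCount_insert hm hS (Finset.mem_range.1 hi) hiS
    have hc : S.card < n := by
      have := Finset.card_le_card (Finset.insert_subset hi hS)
      rw [Finset.card_insert_of_notMem hiS, Finset.card_range] at this
      omega
    rw [ih hS] at h
    rw [Finset.card_insert_of_notMem hiS, Nat.descFactorial_succ]
    obtain ⟨d, rfl⟩ : ∃ d, n = S.card + 1 + d := ⟨n - (S.card + 1), by omega⟩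
    have e1 : S.card + 1 + d - S.card = d + 1 := by omega
    have e2 : S.card + 1 + d - (S.card + 1) = d := by omega
    rw [e1] at h
    rw [e2]
    rw [Nat.factorial_succ] at h
    refine Nat.eq_of_mul_eq_mul_left (Nat.succ_pos d) ?_
    rcases le_or_gt S.card m with hle | hlt
    · obtain ⟨t, rfl⟩ := Nat.exists_eq_add_of_le hle
      rw [Nat.add_sub_cancel_left]
      simp only [Nat.succ_eq_add_one]
      nlinarith
    · rw [Nat.descFactorial_of_lt hlt] at h ⊢
      simpa using h

lemma sum_sum_range_adjacent (a b d : ℝ) (N : ℕ) :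
    ∑ i ∈ Finset.range (N + 1), ∑ j ∈ Finset.range (N + 1),
      (if i = j then a else if i + 1 = j ∨ j + 1 = i then b else d)
      = (N + 1) * a + 2 * N * b + N * (N - 1) * d := by
  set g : ℕ → ℕ → ℝ := fun i j => if i = j then a else if i + 1 = j ∨ j + 1 = i then b else d
    with hg
  have symm (i j : ℕ) : g i j = g j i := by
    simp only [hg, eq_comm (a := i) (b := j), or_comm (a := i + 1 = j)]
  have row (k : ℕ) : ∑ i ∈ Finset.range (k + 1), g i (k + 1) = b + k * d := by
    rw [Finset.sum_range_succ, Finset.sum_congr rfl (g := fun _ => d)]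
    · simp [hg, add_comm]
    · intro i hi
      rw [Finset.mem_range] at hi
      simp only [hg]
      rw [if_neg (by omega), if_neg (by omega)]
  change ∑ i ∈ Finset.range (N + 1), ∑ j ∈ Finset.range (N + 1), g i j = _
  induction N with
  | zero => simp [hg]
  | succ N ih =>
    rw [Finset.sum_range_succ]
    simp only [Finset.sum_range_succ _ (N + 1)]
    rw [Finset.sum_add_distrib, ih, Finset.sum_congr rfl (fun j _ => symm (N + 1) j), row]
    simp only [hg, if_true]
    push_cast
    ring

lemma mul_permInd_eq_prod (n m : ℕ) (σ : Equiv.Perm (Fin n)) (i j : ℕ) :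
    permInd n m σ (i + 1) * permInd n m σ (i + 2)
        * (permInd n m σ (j + 1) * permInd n m σ (j + 2))
      = ∏ k ∈ {i, i + 1} ∪ {j, j + 1}, permInd n m σ (k + 1) := by
  have pair (i : ℕ) : permInd n m σ (i + 1) * permInd n m σ (i + 2)
      = ∏ k ∈ {i, i + 1}, permInd n m σ (k + 1) := by
    rw [Finset.prod_pair (by omega)]
  have bool (S : Finset ℕ) : ∏ k ∈ S, permInd n m σ (k + 1)
      = if ∀ k ∈ S, permInd n m σ (k + 1) = 1 then 1 else 0 := by
    split_ifs with h
    · exact Finset.prod_eq_one h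
    · push Not at h
      obtain ⟨k, hk, h⟩ := h
      exact Finset.prod_eq_zero hk ((permInd_eq_zero_or_one n m σ (k + 1)).resolve_right h)
  rw [pair, pair, bool, bool, bool, ite_zero_mul_ite_zero]
  simp only [Finset.forall_mem_union, mul_one]

lemma card_pair_union_pair (i j : ℕ) :
    (({i, i + 1} : Finset ℕ) ∪ {j, j + 1}).card
      = if i = j then 2 else if i + 1 = j ∨ j + 1 = i then 3 else 4 := by
  split_ifs with h h'
  · subst h
    simp
  · rcases h' with rfl | rfl
    · rw [show ({i, i + 1} : Finset ℕ) ∪ {i + 1, i + 1 + 1} = {i, i + 1, i + 2} by grind]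
      rw [Finset.card_eq_three]
      exact ⟨i, i + 1, i + 2, by omega, by omega, by omega, rfl⟩
    · rw [show ({j + 1, j + 1 + 1} : Finset ℕ) ∪ {j, j + 1} = {j, j + 1, j + 2} by grind]
      rw [Finset.card_eq_three]
      exact ⟨j, j + 1, j + 2, by omega, by omega, by omega, rfl⟩
  · rw [Finset.card_union_of_disjoint, Finset.card_pair (by omega), Finset.card_pair (by omega)]
    rw [Finset.disjoint_left]
    intro x
    simp only [Finset.mem_insert, Finset.mem_singleton]
    omega

/-- The number of adjacent pairs of 1's in the indicator sequence. -/
def adjPairs (N m : ℕ) (σ : Equiv.Perm (Fin (N + 2))) : ℕ :=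
  ∑ i ∈ Finset.range (N + 1), permInd (N + 2) m σ (i + 1) * permInd (N + 2) m σ (i + 2)

lemma sum_adjPairs {N m : ℕ} (hm : m ≤ N + 2) :
    ∑ σ, (adjPairs N m σ : ℝ) = (N + 1) * (m.descFactorial 2 * N.factorial) := by
  have h : ∑ σ, adjPairs N m σ = (N + 1) * (m.descFactorial 2 * N.factorial) := by
    unfold adjPairs
    rw [Finset.sum_comm, Finset.sum_congr rfl (g := fun _ => m.descFactorial 2 * N.factorial)]
    · simp
    · intro i hi
      rw [Finset.mem_range] at hi
      have := indCount_eq hm {i, i + 1} (by intro x; simp; omega)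
      rw [Finset.card_pair (by omega), Nat.add_sub_cancel] at this
      rw [← this, indCount]
      simp
  exact_mod_cast h

lemma sum_adjPairs_sq {N m : ℕ} (hm : m ≤ N + 2) :
    ∑ σ, (adjPairs N m σ : ℝ) ^ 2 = (N + 1) * (m.descFactorial 2 * N.factorial)
      + 2 * N * (m.descFactorial 3 * (N - 1).factorial)
      + N * (N - 1) * (m.descFactorial 4 * (N - 2).factorial) := by
  rw [← sum_sum_range_adjacent]
  have h : ∑ σ, adjPairs N m σ ^ 2 = ∑ i ∈ Finset.range (N + 1), ∑ j ∈ Finset.range (N + 1),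
      indCount (N + 2) m ({i, i + 1} ∪ {j, j + 1}) := by
    simp only [adjPairs, sq, Finset.sum_mul_sum, mul_permInd_eq_prod, indCount]
    rw [Finset.sum_comm]
    exact Finset.sum_congr rfl fun i _ => Finset.sum_comm
  have h' := congrArg (Nat.cast (R := ℝ)) h
  push_cast at h'
  rw [h']
  refine Finset.sum_congr rfl fun i hi => Finset.sum_congr rfl fun j hj => ?_
  rw [Finset.mem_range] at hi hj
  rw [indCount_eq hm, card_pair_union_pair]
  · split_ifs <;> push_cast <;> rfl
  · intro x
    simp only [Finset.mem_union, Finset.mem_insert, Finset.mem_singleton, Finset.mem_range]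
    omega

lemma mul_descFactorial_mul_factorial {N m r : ℕ} (hm : m ≤ N + r) :
    (N : ℝ) * (m.descFactorial (r + 1) * (N - 1).factorial)
      = (m - r) * (m.descFactorial r * N.factorial) := by
  rcases lt_trichotomy m r with h | rfl | h
  · simp [Nat.descFactorial_of_lt h]
  · simp
  · rw [← Nat.mul_factorial_pred (by omega : N ≠ 0), Nat.descFactorial_succ]
    push_cast [h.le]
    ring

theorem stmt4 (n m : ℕ) (hn : 2 ≤ n) (hm : m ≤ n) :
    (∑ σ : Equiv.Perm (Fin n), ((numRuns n (permInd n m σ) : ℝ) -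
          (∑ τ : Equiv.Perm (Fin n), (numRuns n (permInd n m τ) : ℝ))
            / (Fintype.card (Equiv.Perm (Fin n)) : ℝ)) ^ 2)
        / (Fintype.card (Equiv.Perm (Fin n)) : ℝ)
      = (m : ℝ) * ((m : ℝ) - 1) * ((n : ℝ) - m) * ((n : ℝ) - m + 1)
        / ((n : ℝ) ^ 2 * ((n : ℝ) - 1)) := by
  obtain ⟨N, rfl⟩ := Nat.exists_eq_add_of_le' hn
  have hX (σ : Equiv.Perm (Fin (N + 2))) :
      (numRuns (N + 2) (permInd (N + 2) m σ) : ℝ) = m - adjPairs N m σ := by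
    have h := numRuns_add_sum _ (permInd_eq_zero_or_one (N + 2) m σ) (N + 1)
    rw [sum_permInd hm] at h
    rw [eq_sub_iff_add_eq]
    exact_mod_cast h
  have hfac : (N.factorial : ℝ) ≠ 0 := by positivity
  have hcard : (Fintype.card (Equiv.Perm (Fin (N + 2))) : ℝ)
      = (N + 2) * ((N + 1) * N.factorial) := by
    rw [Fintype.card_perm, Fintype.card_fin, Nat.factorial_succ, Nat.factorial_succ]
    push_cast
    ring
  have hd2 : (m.descFactorial 2 : ℝ) = m * (m - 1) := by
    rcases m with _ | m <;> simp [Nat.descFactorial_succ, mul_comm]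
  have h2 := sum_adjPairs hm
  have h3 : (N : ℝ) * (m.descFactorial 3 * (N - 1).factorial)
      = (m - 2) * (m.descFactorial 2 * N.factorial) :=
    mul_descFactorial_mul_factorial (r := 2) hm
  have h4 : (N : ℝ) * (N - 1) * (m.descFactorial 4 * (N - 2).factorial)
      = (m - 3) * ((m - 2) * (m.descFactorial 2 * N.factorial)) := by
    rcases N with _ | N
    · have : m = 0 ∨ m = 1 ∨ m = 2 := by omega
      rcases this with rfl | rfl | rfl <;> simp [Nat.descFactorial]
    · have h := mul_descFactorial_mul_factorial (N := N) (r := 3) (m := m) (by omega)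
      rw [← h3]
      push_cast at h ⊢
      rw [add_sub_cancel_right]
      linear_combination ((N : ℝ) + 1) * h
  have hsq := sum_adjPairs_sq hm
  rw [mul_assoc 2 (N : ℝ), h3, h4, hd2] at hsq
  rw [hd2] at h2
  have hvar (c : ℝ) : ∑ σ, ((m : ℝ) - adjPairs N m σ - c) ^ 2
      = (Fintype.card (Equiv.Perm (Fin (N + 2))) : ℝ) * (m - c) ^ 2
        - 2 * (m - c) * ∑ σ, (adjPairs N m σ : ℝ) + ∑ σ, (adjPairs N m σ : ℝ) ^ 2 := by
    rw [Finset.mul_sum, ← nsmul_eq_mul, ← Finset.card_univ, ← Finset.sum_const,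
      ← Finset.sum_sub_distrib, ← Finset.sum_add_distrib]
    exact Finset.sum_congr rfl fun σ _ => by ring
  simp only [hX]
  rw [hvar, Finset.sum_sub_distrib, Finset.sum_const, Finset.card_univ, nsmul_eq_mul, h2, hsq,
    hcard]
  have : (N : ℝ) + 2 - 1 ≠ 0 := by
    have : (N : ℝ) + 1 ≠ 0 := by positivity
    convert this using 1; ring
  push_cast
  field_simp
  ring
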